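/- (Audenaert–Kittaneh conjecture, case 1 < p ≤ 2) Let A_1,…,A_n be complex square matrices, 1 < p ≤ 2, and 1/p + 1/q = 1. Then ‖∑_{i=1}^n A_i‖_p^q + ∑_{1≤i<j≤n} ‖A_i − A_j‖_p^q ≤ n·(∑_{i=1}^n ‖A_i‖_p^p)^(q/p). -/

import Mathlib

open scoped ComplexOrder

/-- The Schatten `p`-(quasi)norm of a square complex matrix:
`‖X‖_p = (tr |X|^p)^(1/p)`, computed as `(∑ i, λ_i(Xᴴ * X) ^ (p/2)) ^ (1/p)`,
where `λ_i(Xᴴ * X)` are the (nonnegative) eigenvalues of `Xᴴ * X`, whose square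
roots are the singular values of `X`. -/
noncomputable def schattenNorm {m : Type*} [Fintype m] [DecidableEq m]
    (p : ℝ) (X : Matrix m m ℂ) : ℝ :=
  (∑ i, ((Matrix.posSemidef_conjTranspose_mul_self X).1.eigenvalues i ^ (p / 2))) ^ (1 / p)

open Complex.HadamardThreeLines in
/-- An entire function that is bounded on the closed strip `0 ≤ re z ≤ 1`. -/
def EntireBoundedOnStrip (f : ℂ → ℂ) : Prop :=
  Differentiable ℂ f ∧ ∃ C : ℝ, ∀ z ∈ verticalClosedStrip 0 1, ‖f z‖ ≤ C

namespace EntireBoundedOnStrip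

theorem const (c : ℂ) : EntireBoundedOnStrip fun _ => c :=
  ⟨differentiable_const c, ‖c‖, fun _ _ => le_rfl⟩

theorem mul {f g : ℂ → ℂ} (hf : EntireBoundedOnStrip f) (hg : EntireBoundedOnStrip g) :
    EntireBoundedOnStrip fun z => f z * g z := by
  obtain ⟨hf, C, hC⟩ := hf
  obtain ⟨hg, D, hD⟩ := hg
  refine ⟨hf.mul hg, C * D, fun z hz => ?_⟩
  rw [norm_mul]
  exact mul_le_mul (hC z hz) (hD z hz) (norm_nonneg _) ((norm_nonneg _).trans (hC z hz))

theorem sum {ι : Type*} (s : Finset ι) {f : ι → ℂ → ℂ}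
    (hf : ∀ i, EntireBoundedOnStrip (f i)) :
    EntireBoundedOnStrip fun z => ∑ i ∈ s, f i z := by
  choose hd C hC using hf
  refine ⟨by fun_prop, ∑ i ∈ s, C i, fun z hz => ?_⟩
  exact (norm_sum_le _ _).trans (Finset.sum_le_sum fun i _ => hC i z hz)

theorem exp_linear (a b c : ℝ) :
    EntireBoundedOnStrip fun z => Complex.exp ((a * z + b) * c) := by
  refine ⟨by fun_prop, Real.exp (|a| * |c| + |b| * |c|), fun z hz => ?_⟩
  rw [Complex.norm_exp, Real.exp_le_exp]
  have hre : ((a * z + b) * c).re = a * c * z.re + b * c := by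
    simp
    ring
  rw [hre]
  obtain ⟨h0, h1⟩ := hz
  refine add_le_add ?_ ((le_abs_self _).trans (abs_mul _ _).le)
  calc a * c * z.re ≤ |a * c| * z.re := mul_le_mul_of_nonneg_right (le_abs_self _) h0
    _ ≤ |a * c| * 1 := mul_le_mul_of_nonneg_left h1 (abs_nonneg _)
    _ = |a| * |c| := by rw [mul_one, abs_mul]

theorem matrix_mul {m : Type*} [Fintype m] {F G : ℂ → Matrix m m ℂ}
    (hF : ∀ i j, EntireBoundedOnStrip fun z => F z i j)
    (hG : ∀ i j, EntireBoundedOnStrip fun z => G z i j) (i j : m) :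
    EntireBoundedOnStrip fun z => (F z * G z) i j := by
  simp only [Matrix.mul_apply]
  exact sum _ fun k => (hF i k).mul (hG k j)

theorem diagonal {m : Type*} [DecidableEq m] {f : m → ℂ → ℂ}
    (hf : ∀ a, EntireBoundedOnStrip (f a)) (i j : m) :
    EntireBoundedOnStrip fun z => Matrix.diagonal (fun a => f a z) i j := by
  by_cases h : i = j
  · subst h
    simpa using hf i
  · simpa [h] using const 0

/-- Hadamard's three lines theorem. -/
theorem norm_le_interp {f : ℂ → ℂ} (hf : EntireBoundedOnStrip f) {a b t : ℝ}
    (ht0 : 0 ≤ t) (ht1 : t ≤ 1) (ha : ∀ z : ℂ, z.re = 0 → ‖f z‖ ≤ a)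
    (hb : ∀ z : ℂ, z.re = 1 → ‖f z‖ ≤ b) : ‖f t‖ ≤ a ^ (1 - t) * b ^ t := by
  obtain ⟨hd, C, hC⟩ := hf
  simpa using Complex.HadamardThreeLines.norm_le_interp_of_mem_verticalClosedStrip₀₁' f
    (z := t) (a := a) (b := b) ⟨by simpa using ht0, by simpa using ht1⟩ hd.diffContOnCl
    ⟨C, by rintro _ ⟨z, hz, rfl⟩; exact hC z hz⟩ ha hb

end EntireBoundedOnStrip

open Matrix

section Factor

variable {m : Type*} [Fintype m] [DecidableEq m]

/-- A form of the singular value decomposition: `X = Y Vᴴ` with `V` unitary and the columns of `Y`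
orthogonal, of squared lengths the eigenvalues of `Xᴴ X`. -/
theorem exists_schatten_factor (X : Matrix m m ℂ) :
    ∃ (V Y : Matrix m m ℂ) (l : m → ℝ), V ∈ unitaryGroup m ℂ ∧ X = Y * Vᴴ ∧
      Yᴴ * Y = diagonal (fun a => (l a : ℂ)) ∧ (∀ a, 0 ≤ l a) ∧
      ∀ p : ℝ, schattenNorm p X = (∑ a, l a ^ (p / 2)) ^ (1 / p) := by
  have hX := posSemidef_conjTranspose_mul_self X
  refine ⟨hX.1.eigenvectorUnitary, X * hX.1.eigenvectorUnitary, hX.1.eigenvalues,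
    hX.1.eigenvectorUnitary.2, ?_, ?_, hX.eigenvalues_nonneg, fun p => rfl⟩
  · have h := Unitary.coe_mul_star_self hX.1.eigenvectorUnitary
    exact ((mul_assoc _ _ _).trans ((congrArg (X * ·) h).trans (mul_one X))).symm
  · have h := hX.1.conjStarAlgAut_star_eigenvectorUnitary
    rw [Unitary.conjStarAlgAut_apply] at h
    rw [conjTranspose_mul]
    simpa [mul_assoc, star_eq_conjTranspose, Function.comp_def] using h

theorem schattenNorm_nonneg (p : ℝ) (X : Matrix m m ℂ) : 0 ≤ schattenNorm p X := by
  obtain ⟨V, Y, l, -, -, -, hl, h⟩ := exists_schatten_factor X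
  rw [h]
  exact Real.rpow_nonneg (Finset.sum_nonneg fun a _ => Real.rpow_nonneg (hl a) _) _

theorem norm_exp_mul_log_sq_mul {l : ℝ} (hl : 0 ≤ l) {w : ℂ} {s : ℝ} (hs : 2 * w.re + 1 = s)
    (hs0 : s ≠ 0) : ‖Complex.exp (w * Real.log l)‖ ^ 2 * l = l ^ s := by
  rcases hl.eq_or_lt with rfl | hl
  · simp [hs0]
  · rw [Complex.norm_exp, ← Real.exp_nat_mul, Real.rpow_def_of_pos hl, ← hs]
    nth_rw 2 [← Real.exp_log hl]
    rw [← Real.exp_add]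
    congr 1
    simp
    ring

theorem norm_exp_mul_log_sq_mul_le_one {l : ℝ} (hl : 0 ≤ l) {w : ℂ} (hw : 2 * w.re + 1 = 0) :
    ‖Complex.exp (w * Real.log l)‖ ^ 2 * l ≤ 1 := by
  rcases hl.eq_or_lt with rfl | hl
  · simp
  · rw [Complex.norm_exp, ← Real.exp_nat_mul]
    nth_rw 2 [← Real.exp_log hl]
    rw [← Real.exp_add, Real.exp_le_one_iff]
    have : w.re = -(1 / 2) := by linarith
    simp [this]

omit [DecidableEq m] in
theorem sum_norm_sq_eq_trace (Z : Matrix m m ℂ) :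
    ((∑ i, ∑ j, ‖Z i j‖ ^ 2 : ℝ) : ℂ) = trace (Zᴴ * Z) := by
  rw [Finset.sum_comm]
  simp only [trace, diag_apply, mul_apply, conjTranspose_apply]
  push_cast
  refine Finset.sum_congr rfl fun i _ => Finset.sum_congr rfl fun j _ => ?_
  exact (Complex.conj_mul' _).symm

theorem conjTranspose_mul_diagonal_mul_self {Y : Matrix m m ℂ} {l : m → ℝ}
    (hY : Yᴴ * Y = diagonal (fun a => (l a : ℂ))) (f : m → ℂ) :
    (Y * diagonal f)ᴴ * (Y * diagonal f) =
      diagonal (fun a => ((‖f a‖ ^ 2 * l a : ℝ) : ℂ)) := by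
  have : (Y * diagonal f)ᴴ * (Y * diagonal f) = (diagonal f)ᴴ * (Yᴴ * Y) * diagonal f := by
    simp [conjTranspose_mul, mul_assoc]
  rw [this, hY, diagonal_conjTranspose, diagonal_mul_diagonal, diagonal_mul_diagonal]
  congr 1
  ext a
  push_cast
  rw [← Complex.conj_mul', Pi.star_apply, ← starRingEnd_apply]
  ring

theorem sum_norm_sq_mul_unitary {V Z : Matrix m m ℂ} {r : m → ℝ} (hV : V ∈ unitaryGroup m ℂ)
    (hZ : Zᴴ * Z = diagonal (fun a => (r a : ℂ))) :
    ∑ i, ∑ j, ‖(Z * Vᴴ) i j‖ ^ 2 = ∑ a, r a := by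
  apply Complex.ofReal_injective
  have hV' : Vᴴ * V = 1 := mem_unitaryGroup_iff'.1 hV
  rw [sum_norm_sq_eq_trace, conjTranspose_mul, conjTranspose_conjTranspose, mul_assoc,
    trace_mul_comm, ← mul_assoc, mul_assoc _ Vᴴ V, hV', mul_one, hZ, trace_diagonal]
  push_cast
  rfl

open scoped Matrix.Norms.L2Operator

theorem norm_trace_mul_mul_unitary_le {V Z : Matrix m m ℂ} {r : m → ℝ}
    (hV : V ∈ unitaryGroup m ℂ) (hZ : Zᴴ * Z = diagonal (fun a => (r a : ℂ)))
    (B : Matrix m m ℂ) : ‖trace (B * (Z * Vᴴ))‖ ≤ ‖B‖ * ∑ a, √(r a) := by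
  have hcol : ∀ a, ‖WithLp.toLp 2 (fun i => Z i a)‖ = √(r a) := by
    intro a
    rw [EuclideanSpace.norm_eq]
    congr 1
    apply Complex.ofReal_injective
    have := congrFun (congrFun hZ a) a
    rw [diagonal_apply_eq, mul_apply] at this
    rw [← this]
    push_cast
    exact Finset.sum_congr rfl fun i _ => (Complex.conj_mul' _).symm
  have hB : ‖Vᴴ * B‖ = ‖B‖ := by
    have := CStarRing.norm_coe_unitary_mul
      (star (⟨V, hV⟩ : unitary (Matrix m m ℂ))) B
    simpa [star_eq_conjTranspose] using this
  rw [← mul_assoc, trace_mul_comm, ← mul_assoc, ← hB, trace, Finset.mul_sum]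
  refine (norm_sum_le _ _).trans (Finset.sum_le_sum fun a _ => ?_)
  rw [← hcol]
  refine le_trans ?_ (l2_opNorm_mulVec (Vᴴ * B) (WithLp.toLp 2 (fun i => Z i a)))
  exact PiLp.norm_apply_le ((EuclideanSpace.equiv m ℂ).symm ((Vᴴ * B) *ᵥ fun i => Z i a)) a

theorem norm_mul_unitary_le {V Z : Matrix m m ℂ} {r : m → ℝ}
    (hV : V ∈ unitaryGroup m ℂ) (hZ : Zᴴ * Z = diagonal (fun a => (r a : ℂ)))
    (hr0 : ∀ a, 0 ≤ r a) (hr : ∀ a, r a ≤ 1) : ‖Z * Vᴴ‖ ≤ 1 := by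
  have h1 : ‖Z * Vᴴ‖ = ‖Z‖ :=
    CStarRing.norm_mul_mem_unitary _ (star_eq_conjTranspose V ▸ Unitary.star_mem hV)
  have h2 : ‖Z‖ * ‖Z‖ ≤ 1 := by
    rw [← l2_opNorm_conjTranspose_mul_self, hZ, l2_opNorm_diagonal]
    refine (pi_norm_le_iff_of_nonneg zero_le_one).2 fun a => ?_
    rw [Complex.norm_real, Real.norm_of_nonneg (hr0 a)]
    exact hr a
  rw [h1]
  nlinarith [norm_nonneg Z]

/-- The analytic family through `X` used on the `ℓ_p(S_p)` side of the interpolation. -/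
theorem exists_primal_family (X : Matrix m m ℂ) {p q : ℝ} (hp : 1 < p) (hpq : 1 / p + 1 / q = 1) :
    ∃ F : ℂ → Matrix m m ℂ, (∀ i j, EntireBoundedOnStrip fun z => F z i j) ∧
      F ((2 / q : ℝ) : ℂ) = X ∧
      (∀ z : ℂ, z.re = 0 → ∀ B, ‖trace (B * F z)‖ ≤ ‖B‖ * schattenNorm p X ^ p) ∧
      (∀ z : ℂ, z.re = 1 → ∑ i, ∑ j, ‖F z i j‖ ^ 2 = schattenNorm p X ^ p) := by
  obtain ⟨V, Y, l, hV, hX, hY, hl, hnorm⟩ := exists_schatten_factor X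
  have hp0 : 0 < p := by linarith
  have hc : schattenNorm p X ^ p = ∑ a, l a ^ (p / 2) := by
    rw [hnorm, ← Real.rpow_mul (Finset.sum_nonneg fun a _ => Real.rpow_nonneg (hl a) _),
      one_div_mul_cancel hp0.ne', Real.rpow_one]
  set w : ℂ → ℂ := fun z => ((-p / 4 : ℝ) : ℂ) * z + ((p / 2 - 1 / 2 : ℝ) : ℂ) with hw
  have hwre : ∀ z, (w z).re = -p / 4 * z.re + (p / 2 - 1 / 2) := by
    intro z
    rw [hw]
    simp only [Complex.add_re, Complex.re_ofReal_mul, Complex.ofReal_re]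
  refine ⟨fun z => Y * diagonal (fun a => Complex.exp (w z * Real.log (l a))) * Vᴴ, ?_, ?_, ?_, ?_⟩
  · exact EntireBoundedOnStrip.matrix_mul (EntireBoundedOnStrip.matrix_mul
      (fun i j => .const _) (EntireBoundedOnStrip.diagonal fun a => .exp_linear _ _ _))
      (fun i j => .const _)
  · have : w ((2 / q : ℝ) : ℂ) = 0 := by
      have : -p / 4 * (2 / q) + (p / 2 - 1 / 2) = 0 := by
        have : 1 / q = 1 - 1 / p := by linarith
        rw [show 2 / q = 2 * (1 / q) by ring, this]
        field_simp
        ring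
      simp only [hw]
      exact_mod_cast this
    simp only [this, zero_mul, Complex.exp_zero, diagonal_one, mul_one, hX]
  · intro z hz B
    refine (norm_trace_mul_mul_unitary_le hV (conjTranspose_mul_diagonal_mul_self hY _) B).trans
      (le_of_eq ?_)
    rw [hc]
    congr 1
    refine Finset.sum_congr rfl fun a _ => ?_
    rw [norm_exp_mul_log_sq_mul (hl a) (s := p) (by rw [hwre, hz]; ring) hp0.ne',
      Real.sqrt_eq_rpow, ← Real.rpow_mul (hl a)]
    ring_nf
  · intro z hz
    rw [sum_norm_sq_mul_unitary hV (conjTranspose_mul_diagonal_mul_self hY _), hc]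
    exact Finset.sum_congr rfl fun a _ =>
      norm_exp_mul_log_sq_mul (hl a) (by rw [hwre, hz]; ring) (by positivity)

/-- The analytic family, norming for `X`, used on the dual side of the interpolation. -/
theorem exists_dual_family (X : Matrix m m ℂ) {p q : ℝ} (hp : 1 < p) (hq : 0 < q)
    (hpq : 1 / p + 1 / q = 1) :
    ∃ G : ℂ → Matrix m m ℂ, (∀ i j, EntireBoundedOnStrip fun z => G z i j) ∧
      trace (G ((2 / q : ℝ) : ℂ) * X) = ((schattenNorm p X ^ q : ℝ) : ℂ) ∧
      (∀ z : ℂ, z.re = 0 → ‖G z‖ ≤ schattenNorm p X ^ q) ∧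
      (∀ z : ℂ, z.re = 1 → ∑ i, ∑ j, ‖G z i j‖ ^ 2 = schattenNorm p X ^ q) := by
  have hc0 := schattenNorm_nonneg p X
  obtain ⟨V, Y, l, hV, hX, hY, hl, hnorm⟩ := exists_schatten_factor X
  have hp0 : 0 < p := by linarith
  have hc : schattenNorm p X ^ p = ∑ a, l a ^ (p / 2) := by
    rw [hnorm, ← Real.rpow_mul (Finset.sum_nonneg fun a _ => Real.rpow_nonneg (hl a) _),
      one_div_mul_cancel hp0.ne', Real.rpow_one]
  have hqp : p + q = p * q := by
    field_simp at hpq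
    linarith
  clear hnorm
  generalize schattenNorm p X = c at hc hc0
  rcases hc0.eq_or_lt with rfl | hc0
  · exact ⟨fun _ => 0, fun i j => .const 0, by simp [hq.ne'], by simp [hq.ne'],
      by simp [hq.ne']⟩
  set w : ℂ → ℂ := fun z => ((p / 4 : ℝ) : ℂ) * z + ((-1 / 2 : ℝ) : ℂ) with hw
  set β : ℂ → ℂ := fun z => ((-(p + q) / 2 : ℝ) : ℂ) * z + (q : ℂ) with hβ
  have hwre : ∀ z, (w z).re = p / 4 * z.re + -1 / 2 := by
    intro z
    simp only [hw, Complex.add_re, Complex.re_ofReal_mul, Complex.ofReal_re]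
  have hβre : ∀ z, (β z).re = -(p + q) / 2 * z.re + q := by
    intro z
    simp only [hβ, Complex.add_re, Complex.re_ofReal_mul, Complex.ofReal_re]
  have hs : ∀ z, ‖Complex.exp (β z * Real.log c)‖ = c ^ (β z).re := by
    intro z
    rw [Complex.norm_exp, Complex.re_mul_ofReal, Real.rpow_def_of_pos hc0, mul_comm]
  have hadj : ∀ f : m → ℂ, V * diagonal f * Yᴴ = (Y * diagonal (star f) * Vᴴ)ᴴ := by
    intro f
    simp [conjTranspose_mul, mul_assoc, diagonal_conjTranspose]
  refine ⟨fun z => diagonal (fun _ => Complex.exp (β z * Real.log c)) *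
    (V * diagonal (fun a => Complex.exp (w z * Real.log (l a))) * Yᴴ), ?_, ?_, ?_, ?_⟩
  · exact EntireBoundedOnStrip.matrix_mul
      (EntireBoundedOnStrip.diagonal fun a => .exp_linear _ _ _)
      (EntireBoundedOnStrip.matrix_mul (EntireBoundedOnStrip.matrix_mul
        (fun i j => .const _) (EntireBoundedOnStrip.diagonal fun a => .exp_linear _ _ _))
        (fun i j => .const _))
  · have hV' : Vᴴ * V = 1 := mem_unitaryGroup_iff'.1 hV
    have hq1 : 1 / q = 1 - 1 / p := by linarith
    have h1 : w ((2 / q : ℝ) : ℂ) = ((p / 2 - 1 : ℝ) : ℂ) := by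
      have : p / 4 * (2 / q) + -1 / 2 = p / 2 - 1 := by
        rw [show 2 / q = 2 * (1 / q) by ring, hq1]
        field_simp
        ring
      simp only [hw]
      exact_mod_cast this
    have h2 : β ((2 / q : ℝ) : ℂ) = ((q - p : ℝ) : ℂ) := by
      have : -(p + q) / 2 * (2 / q) + q = q - p := by
        rw [hqp]
        field_simp
        ring
      simp only [hβ]
      exact_mod_cast this
    have h3 : ∀ a, Real.exp ((p / 2 - 1) * Real.log (l a)) * l a = l a ^ (p / 2) := by
      intro a
      rcases (hl a).eq_or_lt with h | h
      · rw [← h, mul_zero, Real.zero_rpow (by positivity)]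
      · nth_rw 2 [← Real.exp_log h]
        rw [← Real.exp_add, Real.rpow_def_of_pos h]
        ring_nf
    have h4 : Real.exp ((q - p) * Real.log c) * c ^ p = c ^ q := by
      rw [mul_comm (q - p), ← Real.rpow_def_of_pos hc0, ← Real.rpow_add hc0]
      ring_nf
    simp only [h1, h2]
    rw [← smul_eq_diagonal_mul, smul_mul_assoc, trace_smul, hX]
    rw [show V * diagonal (fun a => Complex.exp (((p / 2 - 1 : ℝ) : ℂ) * Real.log (l a))) * Yᴴ *
      (Y * Vᴴ) = V * (diagonal (fun a => Complex.exp (((p / 2 - 1 : ℝ) : ℂ) * Real.log (l a))) *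
        (Yᴴ * Y) * Vᴴ) by simp only [mul_assoc], trace_mul_comm, mul_assoc, hV', mul_one, hY,
      diagonal_mul_diagonal, trace_diagonal, smul_eq_mul, ← h4, hc, ← Finset.sum_congr rfl
        fun a _ => h3 a]
    push_cast
    rfl
  · intro z hz
    have h : ‖V * diagonal (fun a => Complex.exp (w z * Real.log (l a))) * Yᴴ‖ ≤ 1 := by
      rw [hadj, l2_opNorm_conjTranspose]
      refine norm_mul_unitary_le hV (conjTranspose_mul_diagonal_mul_self hY _)
        (fun a => mul_nonneg (sq_nonneg _) (hl a)) fun a => ?_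
      rw [Pi.star_apply, norm_star]
      exact norm_exp_mul_log_sq_mul_le_one (hl a) (by rw [hwre, hz]; ring)
    beta_reduce
    rw [← smul_eq_diagonal_mul, norm_smul, hs, hβre, hz, mul_zero, zero_add]
    exact mul_le_of_le_one_right (Real.rpow_nonneg hc0.le _) h
  · intro z hz
    simp only [diagonal_mul, norm_mul, mul_pow, ← Finset.mul_sum, hs]
    rw [hadj, Finset.sum_comm]
    simp only [conjTranspose_apply, norm_star]
    rw [sum_norm_sq_mul_unitary hV (conjTranspose_mul_diagonal_mul_self hY _),
      Finset.sum_congr rfl fun a _ => show _ = l a ^ (p / 2) by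
        rw [Pi.star_apply, norm_star]
        exact norm_exp_mul_log_sq_mul (hl a) (by rw [hwre, hz]; ring) (by positivity), ← hc,
      ← Real.rpow_natCast, ← Real.rpow_mul hc0.le, ← Real.rpow_add hc0, hβre, hz]
    congr 1
    push_cast
    ring

end Factor

theorem le_mul_rpow_of_le_interp {S R N p q : ℝ} (hS : 0 ≤ S) (hR : 0 ≤ R) (hN : 0 ≤ N)
    (hq : 0 < q) (hpq : 1 / p + 1 / q = 1)
    (h : S ≤ (S * R) ^ (1 - 2 / q) * (√S * √(N * R)) ^ (2 / q)) : S ≤ N * R ^ (q / p) := by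
  rcases hS.eq_or_lt with rfl | hS
  · exact mul_nonneg hN (Real.rpow_nonneg hR _)
  rcases hR.eq_or_lt with rfl | hR
  · by_cases h2 : 1 - 2 / q = 0
    · have : 2 / q = 1 := by linarith
      rw [this] at h
      simp at h
      linarith
    · rw [mul_zero, Real.zero_rpow h2, zero_mul] at h
      linarith
  have key : (S * R) ^ (1 - 2 / q) * (√S * √(N * R)) ^ (2 / q) =
      S ^ (1 - 1 / q) * (N ^ (1 / q) * R ^ (1 / p)) := by
    have hp : 1 / p = (1 - 2 / q) + 1 / q := by linear_combination hpq
    have hs : 1 - 1 / q = (1 - 2 / q) + 1 / q := by ring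
    rw [← Real.sqrt_mul hS.le, Real.sqrt_eq_rpow, ← Real.rpow_mul (by positivity),
      show 1 / 2 * (2 / q) = 1 / q by ring, Real.mul_rpow hS.le hR.le,
      Real.mul_rpow hS.le (by positivity), Real.mul_rpow hN hR.le, hs, hp,
      Real.rpow_add hS, Real.rpow_add hR]
    ring
  rw [key] at h
  have hsplit : S = S ^ (1 - 1 / q) * S ^ (1 / q) := by
    rw [← Real.rpow_add hS, sub_add_cancel, Real.rpow_one]
  have h1 : S ^ (1 / q) ≤ N ^ (1 / q) * R ^ (1 / p) := by
    refine le_of_mul_le_mul_left ?_ (Real.rpow_pos_of_pos hS (1 - 1 / q))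
    rwa [← hsplit]
  have h2 := Real.rpow_le_rpow (by positivity) h1 hq.le
  rwa [Real.mul_rpow (by positivity) (by positivity), ← Real.rpow_mul hS.le,
    ← Real.rpow_mul hN, ← Real.rpow_mul hR.le, one_div_mul_cancel hq.ne', Real.rpow_one,
    Real.rpow_one, one_div_mul_eq_div] at h2

open scoped Matrix.Norms.L2Operator in
/-- Interpolation for Schatten norms: a scalar matrix `T` with entries bounded by `1`, and of
squared `ℓ₂ → ℓ₂` norm at most `N`, maps `ℓ_p(S_p)` to `ℓ_q(S_p)` with norm at most
`N ^ (1 / q)`. -/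
theorem sum_schattenNorm_rpow_le {m K I : Type*} [Fintype m] [DecidableEq m] [Fintype K]
    [Fintype I] (T : K → I → ℂ) {N : ℝ} (hN : 0 ≤ N) (hT : ∀ k i, ‖T k i‖ ≤ 1)
    (hT2 : ∀ x : I → ℂ, ∑ k, ‖∑ i, T k i * x i‖ ^ 2 ≤ N * ∑ i, ‖x i‖ ^ 2)
    (A : I → Matrix m m ℂ) {p q : ℝ} (hp1 : 1 < p) (hp2 : p ≤ 2) (hpq : 1 / p + 1 / q = 1) :
    ∑ k, schattenNorm p (∑ i, T k i • A i) ^ q ≤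
      N * (∑ i, schattenNorm p (A i) ^ p) ^ (q / p) := by
  have hp0 : 0 < p := by linarith
  have hq' : 0 < 1 / q := by
    have : 1 / p < 1 := (div_lt_one hp0).2 hp1
    linarith
  have hq : 0 < q := one_div_pos.1 hq'
  have ht1 : 2 / q ≤ 1 := by
    have : 1 / 2 ≤ 1 / p := one_div_le_one_div_of_le hp0 hp2
    rw [show 2 / q = 2 * (1 / q) by ring]
    linarith
  choose P hPb hPt hP0 hP1 using fun i => exists_primal_family (A i) hp1 hpq
  choose G hGb hGt hG0 hG1 using
    fun k => exists_dual_family (∑ i, T k i • A i) hp1 hq hpq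
  have hSn : ∀ k, 0 ≤ schattenNorm p (∑ i, T k i • A i) ^ q :=
    fun k => Real.rpow_nonneg (schattenNorm_nonneg _ _) _
  have hRn : ∀ i, 0 ≤ schattenNorm p (A i) ^ p :=
    fun i => Real.rpow_nonneg (schattenNorm_nonneg _ _) _
  set S := ∑ k, schattenNorm p (∑ i, T k i • A i) ^ q with hS
  set R := ∑ i, schattenNorm p (A i) ^ p with hR
  have hS0 : 0 ≤ S := Finset.sum_nonneg fun k _ => hSn k
  have hR0 : 0 ≤ R := Finset.sum_nonneg fun i _ => hRn i
  set f : ℂ → ℂ := fun z => ∑ k, trace (G k z * ∑ i, T k i • P i z) with hf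
  have hfb : EntireBoundedOnStrip f := by
    refine EntireBoundedOnStrip.sum _ fun k => EntireBoundedOnStrip.sum _ fun a =>
      EntireBoundedOnStrip.matrix_mul (hGb k) (fun i j => ?_) a a
    simp only [Matrix.sum_apply, Matrix.smul_apply, smul_eq_mul]
    exact EntireBoundedOnStrip.sum _ fun l => (EntireBoundedOnStrip.const _).mul (hPb l i j)
  have hft : f ((2 / q : ℝ) : ℂ) = (S : ℂ) := by
    simp only [hf, hPt, hGt, hS, Complex.ofReal_sum]
  have hf0 : ∀ z : ℂ, z.re = 0 → ‖f z‖ ≤ S * R := by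
    intro z hz
    rw [hS, Finset.sum_mul]
    refine (norm_sum_le _ _).trans (Finset.sum_le_sum fun k _ => ?_)
    rw [Matrix.mul_sum, trace_sum, hR, Finset.mul_sum]
    refine (norm_sum_le _ _).trans (Finset.sum_le_sum fun i _ => ?_)
    rw [mul_smul_comm, trace_smul, norm_smul]
    exact (mul_le_of_le_one_left (norm_nonneg _) (hT k i)).trans
      ((hP0 i z hz _).trans (mul_le_mul_of_nonneg_right (hG0 k z hz) (hRn i)))
  have hf1 : ∀ z : ℂ, z.re = 1 → ‖f z‖ ≤ √S * √(N * R) := by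
    intro z hz
    have e : f z = ∑ x : K × m × m,
        G x.1 z x.2.1 x.2.2 * (∑ i, T x.1 i • P i z) x.2.2 x.2.1 := by
      simp only [hf, trace, diag_apply, mul_apply, Fintype.sum_prod_type]
    have eG : ∑ x : K × m × m, ‖G x.1 z x.2.1 x.2.2‖ ^ 2 = S := by
      simp only [Fintype.sum_prod_type, hG1 _ z hz, hS]
    have eP : ∑ x : K × m × m, ‖(∑ i, T x.1 i • P i z) x.2.2 x.2.1‖ ^ 2 ≤ N * R := by
      simp only [Fintype.sum_prod_type, Matrix.sum_apply, Matrix.smul_apply, smul_eq_mul]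
      calc ∑ k, ∑ a, ∑ b, ‖∑ i, T k i * P i z b a‖ ^ 2
          = ∑ a, ∑ b, ∑ k, ‖∑ i, T k i * P i z b a‖ ^ 2 := by
            rw [Finset.sum_comm]
            exact Finset.sum_congr rfl fun a _ => Finset.sum_comm
        _ ≤ ∑ a, ∑ b, N * ∑ i, ‖P i z b a‖ ^ 2 :=
            Finset.sum_le_sum fun a _ => Finset.sum_le_sum fun b _ => hT2 _
        _ = N * ∑ i, ∑ b, ∑ a, ‖P i z b a‖ ^ 2 := by
            simp only [← Finset.mul_sum]
            congr 1
            rw [Finset.sum_comm, Finset.sum_comm (s := Finset.univ (α := I))]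
            exact Finset.sum_congr rfl fun b _ => Finset.sum_comm
        _ = N * R := by simp only [hP1 _ z hz, hR]
    rw [e]
    refine (norm_sum_le _ _).trans ?_
    simp only [norm_mul]
    refine (Real.sum_mul_le_sqrt_mul_sqrt _ _ _).trans ?_
    rw [eG]
    exact mul_le_mul_of_nonneg_left (Real.sqrt_le_sqrt eP) (Real.sqrt_nonneg _)
  have key := hfb.norm_le_interp (by positivity) ht1 hf0 hf1
  rw [hft, Complex.norm_real, Real.norm_of_nonneg hS0] at key
  exact le_mul_rpow_of_le_interp hS0 hR0 hN hq hpq key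

theorem sum_sum_Ioi_eq_sum_ite {n : ℕ} (g : Fin n → Fin n → ℝ) :
    ∑ i, ∑ j ∈ Finset.Ioi i, g i j = ∑ i, ∑ j, if i < j then g i j else 0 := by
  refine Finset.sum_congr rfl fun i _ => ?_
  rw [← Finset.sum_filter]
  congr 1
  ext j
  simp

theorem norm_sum_sq_add_sum_norm_sub_sq {n : ℕ} (x : Fin n → ℂ) :
    ‖∑ i, x i‖ ^ 2 + ∑ i, ∑ j, (if i < j then ‖x i - x j‖ ^ 2 else 0) =
      n * ∑ i, ‖x i‖ ^ 2 := by
  have hsymm : ∑ i, ∑ j, (if i < j then ‖x i - x j‖ ^ 2 else 0) +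
      ∑ i, ∑ j, (if i < j then ‖x i - x j‖ ^ 2 else 0) = ∑ i, ∑ j, ‖x i - x j‖ ^ 2 := by
    nth_rw 2 [Finset.sum_comm]
    simp only [← Finset.sum_add_distrib]
    refine Finset.sum_congr rfl fun i _ => Finset.sum_congr rfl fun j _ => ?_
    rcases lt_trichotomy i j with h | rfl | h
    · simp [h, h.not_gt]
    · simp
    · simp [h, h.not_gt, norm_sub_rev]
  have hnorm : ‖∑ i, x i‖ ^ 2 = ∑ i, ∑ j, ((x i).re * (x j).re + (x i).im * (x j).im) := by
    rw [Complex.sq_norm, Complex.normSq_apply, Complex.re_sum, Complex.im_sum,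
      Finset.sum_mul_sum, Finset.sum_mul_sum]
    simp only [Finset.sum_add_distrib]
  have hdiff : ∑ i, ∑ j, ‖x i - x j‖ ^ 2 = ∑ i, ∑ j, (‖x i‖ ^ 2 + ‖x j‖ ^ 2 -
      2 * ((x i).re * (x j).re + (x i).im * (x j).im)) := by
    refine Finset.sum_congr rfl fun i _ => Finset.sum_congr rfl fun j _ => ?_
    simp only [Complex.sq_norm, Complex.normSq_apply, Complex.sub_re, Complex.sub_im]
    ring
  simp only [Finset.sum_sub_distrib, Finset.sum_add_distrib, ← Finset.mul_sum, Finset.sum_const,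
    Finset.card_univ, Fintype.card_fin, nsmul_eq_mul] at hdiff hnorm
  linarith

theorem audenaert_kittaneh_p_le_two {m : Type*} [Fintype m] [DecidableEq m] (n : ℕ)
    (A : Fin n → Matrix m m ℂ)
    (p q : ℝ) (hp1 : 1 < p) (hp2 : p ≤ 2) (hpq : 1 / p + 1 / q = 1) :
    schattenNorm p (∑ i, A i) ^ q +
        ∑ i, ∑ j ∈ Finset.Ioi i, schattenNorm p (A i - A j) ^ q ≤
      n * (∑ i, schattenNorm p (A i) ^ p) ^ (q / p) := by
  let T : Option (Fin n × Fin n) → Fin n → ℂ := fun k i => k.elim 1 fun ab =>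
    if ab.1 < ab.2 then (if i = ab.1 then 1 else 0) - (if i = ab.2 then 1 else 0) else 0
  have hT : ∀ k i, ‖T k i‖ ≤ 1 := by
    rintro (_ | ⟨a, b⟩) i
    · simp [T]
    · simp only [T, Option.elim_some]
      split_ifs <;> simp
  have hT2 : ∀ x : Fin n → ℂ, ∑ k, ‖∑ i, T k i * x i‖ ^ 2 ≤ n * ∑ i, ‖x i‖ ^ 2 := by
    intro x
    rw [← norm_sum_sq_add_sum_norm_sub_sq x, Fintype.sum_option, Fintype.sum_prod_type]
    refine le_of_eq (congrArg₂ _ (by simp [T]) ?_)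
    refine Finset.sum_congr rfl fun a _ => Finset.sum_congr rfl fun b _ => ?_
    by_cases h : a < b <;> simp [T, h, sub_mul]
  refine le_trans ?_ (sum_schattenNorm_rpow_le T n.cast_nonneg hT hT2 A hp1 hp2 hpq)
  rw [Fintype.sum_option, Fintype.sum_prod_type, sum_sum_Ioi_eq_sum_ite]
  refine add_le_add (by simp [T]) (Finset.sum_le_sum fun a _ => Finset.sum_le_sum fun b _ => ?_)
  by_cases h : a < b
  · simp [T, h, sub_smul]
  · simpa [T, h] using Real.rpow_nonneg (schattenNorm_nonneg p (0 : Matrix m m ℂ)) q
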